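/- Let L be a field, m, s, s' ≥ 1, σ₁,…,σ_m pairwise commuting ring automorphisms of L, and K a subfield of L with σᵢ(K) ⊆ K and σᵢ^{−1}(K) ⊆ K for all i. Let η₁,…,η_s ∈ L and ζ₁,…,ζ_{s'} ∈ L be two families such that the smallest subfield of L containing K and all η_j and closed under every σᵢ and every σᵢ^{−1} coincides with the smallest such subfield for the ζ_j. Let ψ_η, ψ_ζ ∈ ℚ[t] be polynomials such that for all sufficiently large r ∈ ℕ, ψ_η(r) = trdeg_K K({γ_k(η_j) : ord γ_k ≤ r, 1 ≤ j ≤ s}) and ψ_ζ(r) = trdeg_K K({γ_k(ζ_j) : ord γ_k ≤ r, 1 ≤ j ≤ s'}). Then deg ψ_η = deg ψ_ζ and the leading coefficients of ψ_η and ψ_ζ are equal. -/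

import Mathlib

open Polynomial

set_option synthInstance.maxHeartbeats 1000000
set_option maxHeartbeats 1000000

/-- Transcendence degree of the `K`-algebra `A`. -/
noncomputable def trdeg (K A : Type*) [CommRing K] [CommRing A] [Algebra K A] : Cardinal :=
  ⨆ s : { s : Set A // AlgebraicIndependent K ((↑) : s → A) }, Cardinal.mk s.1

/-- `γ_k = σ₁^{k₁} ∘ ⋯ ∘ σ_m^{k_m}` (integer exponents) for a family of
automorphisms `σ`. -/
def gammaApply {L : Type*} [Field L] {m : ℕ} (σ : Fin m → RingAut L)
    (k : Fin m → ℤ) : L → L :=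
  (List.ofFn fun i => ⇑(σ i ^ k i)).foldr (· ∘ ·) id

/-- The smallest subfield of `L` containing the subfield `K` and the set `S`
and closed under every automorphism `σ i` and its inverse. -/
def invAdjoin {L : Type*} [Field L] {m : ℕ} (σ : Fin m → RingAut L)
    (K : Subfield L) (S : Set L) : Subfield L :=
  sInf {F : Subfield L | K ≤ F ∧ S ⊆ ↑F ∧
    ∀ i, (∀ x ∈ F, σ i x ∈ F) ∧ (∀ x ∈ F, (σ i)⁻¹ x ∈ F)}

/-- `γ_k` as a ring automorphism. -/
def gam {L : Type*} [Field L] {m : ℕ} (σ : Fin m → RingAut L) (k : Fin m → ℤ) : RingAut L :=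
  (List.ofFn fun i => σ i ^ k i).prod

theorem gammaApply_eq {L : Type*} [Field L] {m : ℕ} (σ : Fin m → RingAut L) (k : Fin m → ℤ)
    (x : L) : gammaApply σ k x = gam σ k x := by
  unfold gammaApply gam
  induction m generalizing x with
  | zero => simp
  | succ n ih =>
    simp only [List.ofFn_succ, List.foldr_cons, List.prod_cons, Function.comp_apply,
      RingAut.mul_apply]
    rw [ih (fun i => σ i.succ) (fun i => k i.succ)]

theorem gam_add {L : Type*} [Field L] {m : ℕ} (σ : Fin m → RingAut L)
    (hcomm : ∀ i j, σ i * σ j = σ j * σ i) (k l : Fin m → ℤ) :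
    gam σ (k + l) = gam σ k * gam σ l := by
  induction m with
  | zero => simp [gam]
  | succ n ih =>
    have h := ih (fun i => σ i.succ) (fun i j => hcomm _ _) (fun i => k i.succ)
      (fun i => l i.succ)
    have hc : Commute (σ 0 ^ l 0) (gam (fun i : Fin n => σ i.succ) (fun i => k i.succ)) := by
      apply Commute.list_prod_right
      intro x hx
      obtain ⟨i, rfl⟩ := (List.mem_ofFn' _ _).1 hx
      exact Commute.zpow_zpow (hcomm 0 i.succ) _ _
    simp only [gam, List.ofFn_succ, List.prod_cons, Pi.add_apply] at h hc ⊢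
    rw [h, zpow_add, mul_assoc, mul_assoc, ← mul_assoc (σ 0 ^ l 0), hc.eq]
    simp only [mul_assoc]

theorem gam_zero {L : Type*} [Field L] {m : ℕ} (σ : Fin m → RingAut L) :
    gam σ 0 = 1 := by
  simp [gam]

theorem gam_single {L : Type*} [Field L] {m : ℕ} (σ : Fin m → RingAut L) (i : Fin m) (e : ℤ) :
    gam σ (Pi.single i e) = σ i ^ e := by
  induction m with
  | zero => exact i.elim0
  | succ n ih =>
    refine Fin.cases ?_ (fun j => ?_) i
    · simp [gam, List.ofFn_succ]
    · have h := ih (fun i => σ i.succ) j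
      have h2 : (fun i : Fin n => (Pi.single j.succ e : Fin (n+1) → ℤ) i.succ)
          = Pi.single j e := by
        ext a
        simp [Pi.single_apply]
      unfold gam at h ⊢
      rw [← h2] at h
      rw [List.ofFn_succ, List.prod_cons, h]
      simp [Pi.single_apply, (Fin.succ_ne_zero j).symm]

theorem gam_mem {L : Type*} [Field L] {m : ℕ} (σ : Fin m → RingAut L) (F : Subfield L)
    (h : ∀ i, ∀ x ∈ F, σ i x ∈ F) (h' : ∀ i, ∀ x ∈ F, (σ i)⁻¹ x ∈ F)
    (k : Fin m → ℤ) (x : L) (hx : x ∈ F) : gam σ k x ∈ F := by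
  have key : ∀ τ : RingAut L, (∀ x ∈ F, τ x ∈ F) → ∀ n : ℕ, ∀ x ∈ F, (τ ^ n) x ∈ F := by
    intro τ hτ n
    induction n with
    | zero => intro x hx; simpa using hx
    | succ n ih => intro x hx; rw [pow_succ, RingAut.mul_apply]; exact ih _ (hτ _ hx)
  have key2 : ∀ i, ∀ e : ℤ, ∀ x ∈ F, (σ i ^ e) x ∈ F := by
    intro i e
    obtain ⟨n, rfl | rfl⟩ := e.eq_nat_or_neg
    · intro x hx; rw [zpow_natCast]; exact key _ (h i) n x hx
    · intro x hx; rw [zpow_neg, zpow_natCast, ← inv_pow]; exact key _ (h' i) n x hx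
  have key3 : ∀ l : List (RingAut L), (∀ τ ∈ l, ∀ x ∈ F, τ x ∈ F) → ∀ x ∈ F, l.prod x ∈ F := by
    intro l
    induction l with
    | nil => intro _ x hx; simpa using hx
    | cons a l ih =>
      intro hl x hx
      rw [List.prod_cons, RingAut.mul_apply]
      exact hl a (by simp) _ (ih (fun τ hτ => hl τ (by simp [hτ])) x hx)
  refine key3 _ ?_ x hx
  intro τ hτ
  obtain ⟨i, rfl⟩ := (List.mem_ofFn' _ _).1 hτ
  exact key2 i _

/-- The field `K({γ_k(η_j) : ord γ_k ≤ r})`. -/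
def Fil {L : Type*} [Field L] {m s : ℕ} (σ : Fin m → RingAut L) (K : Subfield L)
    (η : Fin s → L) (r : ℕ) : IntermediateField K L :=
  IntermediateField.adjoin ↥K
    {x : L | ∃ k : Fin m → ℤ, (∑ i, (k i).natAbs) ≤ r ∧ ∃ j : Fin s, x = gammaApply σ k (η j)}

theorem Fil_mono {L : Type*} [Field L] {m s : ℕ} (σ : Fin m → RingAut L) (K : Subfield L)
    (η : Fin s → L) {r r' : ℕ} (h : r ≤ r') : Fil σ K η r ≤ Fil σ K η r' := by
  apply IntermediateField.adjoin.mono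
  rintro x ⟨k, hk, j, rfl⟩
  exact ⟨k, hk.trans h, j, rfl⟩

theorem Fil_gam {L : Type*} [Field L] {m s : ℕ} (σ : Fin m → RingAut L)
    (hcomm : ∀ i j, σ i * σ j = σ j * σ i) (K : Subfield L)
    (hK : ∀ i, ∀ x ∈ K, σ i x ∈ K) (hK' : ∀ i, ∀ x ∈ K, (σ i)⁻¹ x ∈ K)
    (η : Fin s → L) (r : ℕ) (k : Fin m → ℤ) (x : L) (hx : x ∈ Fil σ K η r) :
    gam σ k x ∈ Fil σ K η (∑ i, (k i).natAbs + r) := by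
  induction hx using IntermediateField.adjoin_induction with
  | mem x hx =>
    obtain ⟨l, hl, j, rfl⟩ := hx
    apply IntermediateField.subset_adjoin
    refine ⟨k + l, ?_, j, ?_⟩
    · refine le_trans ?_ (Nat.add_le_add_left hl _)
      rw [← Finset.sum_add_distrib]
      exact Finset.sum_le_sum fun i _ => Int.natAbs_add_le _ _
    · rw [gammaApply_eq, gammaApply_eq, gam_add σ hcomm, RingAut.mul_apply]
  | algebraMap x =>
    exact IntermediateField.algebraMap_mem _ (⟨_, gam_mem σ K hK hK' k x.1 x.2⟩ : K)
  | add x y _ _ hx hy => rw [map_add]; exact add_mem hx hy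
  | inv x _ hx => rw [map_inv₀]; exact inv_mem hx
  | mul x y _ _ hx hy => rw [map_mul]; exact mul_mem hx hy

/-- Union of the filtration. -/
def FilU {L : Type*} [Field L] {m s : ℕ} (σ : Fin m → RingAut L) (K : Subfield L)
    (η : Fin s → L) : Subfield L where
  carrier := {x | ∃ p, x ∈ Fil σ K η p}
  mul_mem' := by
    rintro a b ⟨p, hp⟩ ⟨q, hq⟩
    exact ⟨max p q, mul_mem (Fil_mono σ K η (le_max_left _ _) hp)
      (Fil_mono σ K η (le_max_right _ _) hq)⟩
  one_mem' := ⟨0, one_mem _⟩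
  add_mem' := by
    rintro a b ⟨p, hp⟩ ⟨q, hq⟩
    exact ⟨max p q, add_mem (Fil_mono σ K η (le_max_left _ _) hp)
      (Fil_mono σ K η (le_max_right _ _) hq)⟩
  zero_mem' := ⟨0, zero_mem _⟩
  neg_mem' := by
    rintro a ⟨p, hp⟩
    exact ⟨p, neg_mem hp⟩
  inv_mem' := by
    rintro a ⟨p, hp⟩
    exact ⟨p, inv_mem hp⟩

theorem invAdjoin_le {L : Type*} [Field L] {m s : ℕ} (σ : Fin m → RingAut L)
    (hcomm : ∀ i j, σ i * σ j = σ j * σ i) (K : Subfield L)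
    (hK : ∀ i, ∀ x ∈ K, σ i x ∈ K) (hK' : ∀ i, ∀ x ∈ K, (σ i)⁻¹ x ∈ K)
    (η : Fin s → L) : invAdjoin σ K (Set.range η) ≤ FilU σ K η := by
  apply sInf_le
  refine ⟨fun x hx => ⟨0, IntermediateField.algebraMap_mem _ (⟨x, hx⟩ : K)⟩, ?_, fun i => ⟨?_, ?_⟩⟩
  · rintro _ ⟨j, rfl⟩
    refine ⟨0, IntermediateField.subset_adjoin _ _ ⟨0, by simp, j, ?_⟩⟩
    rw [gammaApply_eq, gam_zero, RingAut.one_apply]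
  · rintro x ⟨p, hp⟩
    have := Fil_gam σ hcomm K hK hK' η p (Pi.single i 1) x hp
    rw [gam_single, zpow_one] at this
    exact ⟨_, this⟩
  · rintro x ⟨p, hp⟩
    have := Fil_gam σ hcomm K hK hK' η p (Pi.single i (-1)) x hp
    rw [gam_single, zpow_neg, zpow_one] at this
    exact ⟨_, this⟩

theorem Fil_shift {L : Type*} [Field L] {m s s' : ℕ} (σ : Fin m → RingAut L)
    (hcomm : ∀ i j, σ i * σ j = σ j * σ i) (K : Subfield L)
    (hK : ∀ i, ∀ x ∈ K, σ i x ∈ K) (hK' : ∀ i, ∀ x ∈ K, (σ i)⁻¹ x ∈ K)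
    (η : Fin s → L) (ζ : Fin s' → L)
    (hgen : invAdjoin σ K (Set.range ζ) ≤ invAdjoin σ K (Set.range η)) :
    ∃ p, ∀ r, Fil σ K ζ r ≤ Fil σ K η (r + p) := by
  have h1 : ∀ j, ∃ p, ζ j ∈ Fil σ K η p := by
    intro j
    refine invAdjoin_le σ hcomm K hK hK' η (hgen ?_)
    exact Subfield.mem_sInf.2 fun F hF => hF.2.1 ⟨j, rfl⟩
  choose p hp using h1
  refine ⟨∑ j, p j, fun r => ?_⟩
  apply IntermediateField.adjoin_le_iff.2
  rintro x ⟨k, hk, j, rfl⟩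
  rw [gammaApply_eq]
  refine Fil_mono σ K η (Nat.add_le_add hk ?_) (Fil_gam σ hcomm K hK hK' η _ k _ (hp j))
  exact Finset.single_le_sum (f := p) (fun _ _ => Nat.zero_le _) (Finset.mem_univ j)

theorem lead_nonneg (f : Polynomial ℚ) (N : ℕ) (h : ∀ r : ℕ, N ≤ r → 0 ≤ f.eval (r : ℚ)) :
    0 ≤ f.leadingCoeff := by
  by_contra! hneg
  by_cases hd : 0 < f.degree
  · have ht := (f.tendsto_atBot_of_leadingCoeff_nonpos hd hneg.le).comp
      (tendsto_natCast_atTop_atTop (R := ℚ))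
    obtain ⟨r, hr, hr'⟩ := ((ht.eventually (Filter.eventually_lt_atBot 0)).and
      (Filter.eventually_ge_atTop N)).exists
    exact absurd (h r hr') (not_le.2 hr)
  · rw [Polynomial.eq_C_of_degree_le_zero (not_lt.1 hd)] at h hneg
    have := h N le_rfl
    simp only [Polynomial.eval_C, Polynomial.leadingCoeff_C] at this hneg
    exact absurd this (not_le.2 hneg)

theorem poly_half (f g : Polynomial ℚ) (N p : ℕ) (hf : ∀ r : ℕ, N ≤ r → 0 ≤ f.eval (r : ℚ))
    (h : ∀ r : ℕ, N ≤ r → f.eval (r : ℚ) ≤ g.eval ((r + p : ℕ) : ℚ)) :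
    f.degree ≤ g.degree ∧ (f.degree = g.degree → f.leadingCoeff ≤ g.leadingCoeff) := by
  have h0 := lead_nonneg f N hf
  have h1 : 0 ≤ (Polynomial.taylor (p : ℚ) g - f).leadingCoeff := by
    apply lead_nonneg _ N
    intro r hr
    have := h r hr
    rw [Polynomial.eval_sub, Polynomial.taylor_eval]
    push_cast at this
    linarith
  constructor
  · by_contra! hlt
    rw [Polynomial.leadingCoeff_sub_of_degree_lt' (by rwa [Polynomial.degree_taylor])] at h1
    have : f.leadingCoeff = 0 := by linarith
    rw [Polynomial.leadingCoeff_eq_zero] at this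
    subst this
    simp at hlt
  · intro he
    by_contra! hlt
    rw [Polynomial.leadingCoeff_sub_of_degree_eq (by rw [Polynomial.degree_taylor, he])
      (by rw [Polynomial.leadingCoeff_taylor]; exact hlt.ne), Polynomial.leadingCoeff_taylor] at h1
    linarith

theorem trdeg_mono {L : Type*} [Field L] (K : Subfield L) (E F : IntermediateField K L)
    (h : E ≤ F) : trdeg K E ≤ trdeg K F :=
  _root_.trdeg_le_of_injective (R := K) (IntermediateField.inclusion h)
    (IntermediateField.inclusion_injective h)

theorem half_main {L : Type*} [Field L] {m s s' : ℕ} (σ : Fin m → RingAut L)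
    (hcomm : ∀ i j, σ i * σ j = σ j * σ i) (K : Subfield L)
    (hK : ∀ i, ∀ x ∈ K, σ i x ∈ K) (hK' : ∀ i, ∀ x ∈ K, (σ i)⁻¹ x ∈ K)
    (η : Fin s → L) (ζ : Fin s' → L)
    (hgen : invAdjoin σ K (Set.range ζ) ≤ invAdjoin σ K (Set.range η))
    (ψη ψζ : Polynomial ℚ)
    (hη : ∃ N : ℕ, ∀ r : ℕ, N ≤ r → ∃ d : ℕ,
      trdeg ↥K ↥(Fil σ K η r) = (d : Cardinal) ∧ ψη.eval (r : ℚ) = (d : ℚ))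
    (hζ : ∃ N : ℕ, ∀ r : ℕ, N ≤ r → ∃ d : ℕ,
      trdeg ↥K ↥(Fil σ K ζ r) = (d : Cardinal) ∧ ψζ.eval (r : ℚ) = (d : ℚ)) :
    ψζ.degree ≤ ψη.degree ∧ (ψζ.degree = ψη.degree → ψζ.leadingCoeff ≤ ψη.leadingCoeff) := by
  obtain ⟨N, hN⟩ := hη
  obtain ⟨M, hM⟩ := hζ
  obtain ⟨p, hp⟩ := Fil_shift σ hcomm K hK hK' η ζ hgen
  apply poly_half ψζ ψη (max N M) p
  · intro r hr
    obtain ⟨d, -, hd⟩ := hM r ((le_max_right _ _).trans hr)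
    rw [hd]
    positivity
  · intro r hr
    obtain ⟨d, hd1, hd⟩ := hM r ((le_max_right _ _).trans hr)
    obtain ⟨e, he1, he⟩ := hN (r + p) (((le_max_left _ _).trans hr).trans (Nat.le_add_right _ _))
    rw [hd, he]
    have := trdeg_mono K _ _ (hp r)
    rw [hd1, he1] at this
    exact_mod_cast this

/-- Invariance of the inversive difference dimension polynomial (Theorem
III.4(iii)): if two finite families `η`, `ζ` generate the same inversive
difference field extension of `K`, then the associated dimension polynomials
have the same degree and the same leading coefficient. -/
theorem inversive_difference_dimension_polynomial_invariants
    (L : Type*) [Field L] (m s s' : ℕ) (hm : 1 ≤ m) (hs : 1 ≤ s) (hs' : 1 ≤ s')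
    (σ : Fin m → RingAut L)
    (hcomm : ∀ i j, σ i * σ j = σ j * σ i)
    (K : Subfield L) (hK : ∀ i, ∀ x ∈ K, σ i x ∈ K)
    (hK' : ∀ i, ∀ x ∈ K, (σ i)⁻¹ x ∈ K)
    (η : Fin s → L) (ζ : Fin s' → L)
    (hgen : invAdjoin σ K (Set.range η) = invAdjoin σ K (Set.range ζ))
    (ψη ψζ : Polynomial ℚ)
    (hη : ∃ N : ℕ, ∀ r : ℕ, N ≤ r → ∃ d : ℕ,
      trdeg ↥K ↥(IntermediateField.adjoin ↥K
          {x : L | ∃ k : Fin m → ℤ, (∑ i, (k i).natAbs) ≤ r ∧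
            ∃ j : Fin s, x = gammaApply σ k (η j)}) = (d : Cardinal) ∧
      ψη.eval (r : ℚ) = (d : ℚ))
    (hζ : ∃ N : ℕ, ∀ r : ℕ, N ≤ r → ∃ d : ℕ,
      trdeg ↥K ↥(IntermediateField.adjoin ↥K
          {x : L | ∃ k : Fin m → ℤ, (∑ i, (k i).natAbs) ≤ r ∧
            ∃ j : Fin s', x = gammaApply σ k (ζ j)}) = (d : Cardinal) ∧
      ψζ.eval (r : ℚ) = (d : ℚ)) :
    ψη.degree = ψζ.degree ∧ ψη.leadingCoeff = ψζ.leadingCoeff := by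
  have h1 := half_main σ hcomm K hK hK' η ζ hgen.ge ψη ψζ hη hζ
  have h2 := half_main σ hcomm K hK hK' ζ η hgen.le ψζ ψη hζ hη
  have hd := le_antisymm h2.1 h1.1
  exact ⟨hd, le_antisymm (h2.2 hd) (h1.2 hd.symm)⟩
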